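/- Let f : ℝ^d → 𝒴 be any deterministic function into a finite set of classes 𝒴, let μ = (μ₁,…,μ_d) ∈ ℝ^d and σ₁,…,σ_d > 0, and let ε be a random vector in ℝ^d whose i-th coordinate is an independent Gaussian N(μ_i, σ_i²). Suppose that for a specific x ∈ ℝ^d there exist a class c_A ∈ 𝒴 and reals p_A, p_B ∈ [0,1] such that P(f(x+ε)=c_A) ≥ p_A ≥ p_B ≥ max_{c ≠ c_A} P(f(x+ε)=c). Then for every δ ∈ ℝ^d with ‖δ‖₂ < R, where R = (1/2)·(min_i σ_i)·(Φ⁻¹(p_A) − Φ⁻¹(p_B)), one has P(f(x+δ+ε)=c_A) > P(f(x+δ+ε)=c) for all c ≠ c_A. -/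

import Mathlib

open MeasureTheory ProbabilityTheory

/-- The cumulative distribution function of the standard normal distribution `N(0,1)`. -/
noncomputable def Phi : ℝ → ℝ :=
  fun x => ((gaussianReal 0 1) (Set.Iic x)).toReal

/-- The inverse of the standard normal CDF. -/
noncomputable def PhiInv : ℝ → ℝ := Function.invFun Phi

/-- standard gaussian -/
noncomputable def stdG (d : ℕ) : Measure (Fin d → ℝ) := Measure.pi fun _ => gaussianReal 0 1

instance (d : ℕ) : IsProbabilityMeasure (stdG d) := by unfold stdG; infer_instance

lemma gauss_shift_1d (w : ℝ) (s : Set ℝ) (hs : MeasurableSet s) :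
    gaussianReal w 1 s =
      ENNReal.ofReal (∫ z, s.indicator (fun z => Real.exp (w * z - w ^ 2 / 2)) z ∂gaussianReal 0 1) := by
  rw [gaussianReal_apply_eq_integral _ one_ne_zero, integral_gaussianReal_eq_integral_smul one_ne_zero,
    ← integral_indicator hs]
  congr 2
  ext z
  by_cases hz : z ∈ s
  · simp only [hz, Set.indicator_of_mem, gaussianPDFReal, smul_eq_mul]
    rw [mul_assoc (Real.sqrt _)⁻¹, ← Real.exp_add]
    congr 2
    simp
    ring
  · simp [hz]

lemma integrable_1d (w : ℝ) :
    Integrable (fun z => Real.exp (w * z - w ^ 2 / 2)) (gaussianReal 0 1) := by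
  simp_rw [Real.exp_sub]
  exact (integrable_exp_mul_gaussianReal w).div_const _

noncomputable def dens {d : ℕ} (w : Fin d → ℝ) (z : Fin d → ℝ) : ℝ :=
  ∏ i, Real.exp (w i * z i - w i ^ 2 / 2)

lemma dens_nonneg {d : ℕ} (w z : Fin d → ℝ) : 0 ≤ dens w z :=
  Finset.prod_nonneg fun _ _ => (Real.exp_pos _).le

lemma dens_eq {d : ℕ} (w z : Fin d → ℝ) :
    dens w z = Real.exp (∑ i, w i * z i - (∑ i, w i ^ 2) / 2) := by
  rw [dens, ← Real.exp_sum, Finset.sum_sub_distrib, Finset.sum_div]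

lemma integrable_dens {d : ℕ} (w : Fin d → ℝ) : Integrable (dens w) (stdG d) := by
  unfold dens stdG
  exact Integrable.fintype_prod (f := fun i z => Real.exp (w i * z - w i ^ 2 / 2))
    (fun i => integrable_1d (w i))

lemma shift_map {d : ℕ} (w : Fin d → ℝ) :
    (stdG d).map (fun z => z + w) = (stdG d).withDensity (fun z => ENNReal.ofReal (dens w z)) := by
  have h1 : (stdG d).map (fun z => z + w) = Measure.pi fun i => gaussianReal (w i) 1 := by
    have hm : ∀ i, (gaussianReal 0 1).map (fun z => z + w i) = gaussianReal (w i) 1 := by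
      intro i; rw [gaussianReal_map_add_const]; simp
    have := Measure.pi_map_pi (μ := fun _ : Fin d => gaussianReal 0 1)
      (f := fun i z => z + w i) (hμ := fun i => by rw [hm]; infer_instance)
      (fun i => by fun_prop)
    simp_rw [hm] at this
    exact this
  rw [h1]
  refine Measure.pi_eq fun s hs => ?_
  have hS : MeasurableSet (Set.pi Set.univ s) := MeasurableSet.univ_pi hs
  rw [withDensity_apply _ hS, ← ofReal_integral_eq_lintegral_ofReal (integrable_dens w).restrict
    (ae_of_all _ (dens_nonneg w)), ← integral_indicator hS]
  have : (Set.pi Set.univ s).indicator (dens w) = fun z =>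
      ∏ i, (s i).indicator (fun z => Real.exp (w i * z - w i ^ 2 / 2)) (z i) := by
    ext z
    by_cases hz : z ∈ Set.pi Set.univ s
    · rw [Set.indicator_of_mem hz, dens]
      exact Finset.prod_congr rfl fun i _ => by rw [Set.indicator_of_mem (hz i trivial)]
    · rw [Set.indicator_of_notMem hz]
      simp only [Set.mem_pi, Set.mem_univ, true_imp_iff, not_forall] at hz
      obtain ⟨i, hi⟩ := hz
      exact (Finset.prod_eq_zero (Finset.mem_univ i) (Set.indicator_of_notMem hi _)).symm
  rw [this, stdG, integral_fintype_prod_eq_prod, ENNReal.ofReal_prod_of_nonneg]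
  · exact Finset.prod_congr rfl fun i _ => (gauss_shift_1d _ _ (hs i)).symm
  · exact fun i _ => integral_nonneg fun z => Set.indicator_nonneg (fun _ _ => (Real.exp_pos _).le) _

lemma shift_real {d : ℕ} (w : Fin d → ℝ) {A : Set (Fin d → ℝ)} (hA : MeasurableSet A) :
    (stdG d).real {z | z + w ∈ A} = ∫ z in A, dens w z ∂stdG d := by
  have h : (stdG d) {z | z + w ∈ A} = ((stdG d).map (fun z => z + w)) A :=
    (Measure.map_apply (by fun_prop) hA).symm
  rw [Measure.real, h, shift_map, withDensity_apply _ hA,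
    ← ofReal_integral_eq_lintegral_ofReal (integrable_dens w).restrict
    (ae_of_all _ (dens_nonneg w)), ENNReal.toReal_ofReal (integral_nonneg (dens_nonneg w))]

lemma law_T {d : ℕ} (w : Fin d → ℝ) :
    (stdG d).map (fun z => ∑ i, w i * z i) =
      (gaussianReal 0 1).map (fun z => Real.sqrt (∑ i, w i ^ 2) * z) := by
  have hm : Measurable (fun z : Fin d → ℝ => ∑ i, w i * z i) := by fun_prop
  have := Measure.isProbabilityMeasure_map (μ := stdG d) hm.aemeasurable
  rw [gaussianReal_map_const_mul]
  refine Measure.ext_of_charFun (funext fun t => ?_)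
  rw [charFun_gaussianReal, charFun_apply_real, integral_map hm.aemeasurable (by fun_prop)]
  have : ∀ z : Fin d → ℝ, Complex.exp (t * ((∑ i, w i * z i : ℝ) : ℂ) * Complex.I) =
      ∏ i, Complex.exp (((t * w i : ℝ) : ℂ) * z i * Complex.I) := by
    intro z
    rw [← Complex.exp_sum]
    congr 1
    push_cast
    rw [Finset.mul_sum, Finset.sum_mul]
    exact Finset.sum_congr rfl fun i _ => by ring
  simp_rw [this]
  rw [stdG, integral_fintype_prod_eq_prod (f := fun i (z : ℝ) =>
    Complex.exp (((t * w i : ℝ) : ℂ) * z * Complex.I))]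
  simp_rw [← charFun_apply_real, charFun_gaussianReal]
  rw [← Complex.exp_sum]
  congr 1
  have h0 : 0 ≤ ∑ i, w i ^ 2 := Finset.sum_nonneg fun i _ => sq_nonneg _
  have h2 : (((NNReal.mk (Real.sqrt (∑ i, w i ^ 2) ^ 2) (sq_nonneg _) * 1 : NNReal) : ℝ) : ℂ)
      = ∑ i, (w i : ℂ) ^ 2 := by
    rw [mul_one]
    simp only [NNReal.coe_mk]
    rw [Real.sq_sqrt h0]; push_cast; rfl
  rw [h2]
  simp
  rw [Finset.sum_mul, Finset.sum_div]
  exact Finset.sum_congr rfl fun i _ => by ring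

lemma half_space {d : ℕ} (w : Fin d → ℝ) (hs : 0 < Real.sqrt (∑ i, w i ^ 2)) (a : ℝ) :
    (stdG d).real {z | ∑ i, w i * z i ≤ Real.sqrt (∑ i, w i ^ 2) * a} = Phi a := by
  have hm : Measurable (fun z : Fin d → ℝ => ∑ i, w i * z i) := by fun_prop
  set s := Real.sqrt (∑ i, w i ^ 2)
  have : (stdG d) {z | ∑ i, w i * z i ≤ s * a} =
      ((stdG d).map (fun z => ∑ i, w i * z i)) (Set.Iic (s * a)) :=
    (Measure.map_apply hm measurableSet_Iic).symm
  rw [Measure.real, this, law_T, Measure.map_apply (by fun_prop) measurableSet_Iic, Phi]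
  congr 2
  ext z
  simp only [Set.mem_preimage, Set.mem_Iic]
  exact mul_le_mul_iff_right₀ hs

lemma np {d : ℕ} (w : Fin d → ℝ) {A : Set (Fin d → ℝ)} (hA : MeasurableSet A) (a : ℝ)
    (h : Phi a ≤ (stdG d).real A) :
    Phi (a - Real.sqrt (∑ i, w i ^ 2)) ≤ (stdG d).real {z | z + w ∈ A} := by
  have h0 : 0 ≤ ∑ i, w i ^ 2 := Finset.sum_nonneg fun i _ => sq_nonneg _
  rcases (Real.sqrt_nonneg (∑ i, w i ^ 2)).eq_or_lt with hs | hs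
  · have : w = 0 := by
      have := (Real.sqrt_eq_zero h0).1 hs.symm
      ext i
      simpa using (Finset.sum_eq_zero_iff_of_nonneg fun i _ => sq_nonneg (w i)).1 this i
        (Finset.mem_univ i)
    subst this
    simpa using h
  have hsq := Real.sq_sqrt h0
  have hS1 := half_space w hs a
  have hS2 := half_space w hs (a - Real.sqrt (∑ i, w i ^ 2))
  set s := Real.sqrt (∑ i, w i ^ 2) with hsdef
  set H := {z : Fin d → ℝ | ∑ i, w i * z i ≤ s * a} with hH
  have hHm : MeasurableSet H := measurableSet_le (by fun_prop) (by fun_prop)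
  have e : {z : Fin d → ℝ | ∑ i, w i * z i ≤ s * (a - s)} = {z | z + w ∈ H} := by
    ext z
    simp only [hH, Set.mem_ofPred_eq, Pi.add_apply, mul_add, Finset.sum_add_distrib]
    have : ∑ i, w i * w i = s * s := by rw [← sq, hsq]; simp [sq]
    rw [this, mul_sub]
    constructor <;> intro h <;> linarith
  rw [← hS2, e, shift_real w hA, shift_real w hHm]
  rw [← hS1] at h
  set t := Real.exp (s * a - s ^ 2 / 2) with ht
  have ht0 : 0 < t := Real.exp_pos _
  have hL := integrable_dens w
  have key : ∫ z in H, (dens w z - t) ∂stdG d ≤ ∫ z in A, (dens w z - t) ∂stdG d := by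
    rw [← integral_indicator hHm, ← integral_indicator hA]
    have hi : Integrable (fun z => dens w z - t) (stdG d) := hL.sub (integrable_const t)
    refine integral_mono (hi.indicator hHm) (hi.indicator hA) fun z => ?_
    by_cases hz : z ∈ H
    · have : dens w z - t ≤ 0 := by
        rw [dens_eq, ht, sub_nonpos, Real.exp_le_exp, ← hsq]
        have : ∑ i, w i * z i ≤ s * a := hz
        linarith
      by_cases hz' : z ∈ A <;> simp [hz, hz', this]
    · have : 0 ≤ dens w z - t := by
        rw [dens_eq, ht, sub_nonneg, Real.exp_le_exp, ← hsq]
        have : ¬ ∑ i, w i * z i ≤ s * a := hz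
        linarith
      by_cases hz' : z ∈ A <;> simp [hz, hz']
      linarith
  rw [integral_sub hL.integrableOn (integrable_const t).integrableOn,
    integral_sub hL.integrableOn (integrable_const t).integrableOn] at key
  simp only [setIntegral_const, smul_eq_mul] at key
  nlinarith

lemma Phi_strictMono : StrictMono Phi := by
  intro a b hab
  have e : (gaussianReal 0 1).real (Set.Iic b) = (gaussianReal 0 1).real (Set.Iic a) +
      (gaussianReal 0 1).real (Set.Ioc a b) := by
    rw [← measureReal_union (Set.Iic_disjoint_Ioc le_rfl) measurableSet_Ioc,
      Set.Iic_union_Ioc_eq_Iic hab.le]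
  have : 0 < (gaussianReal 0 1).real (Set.Ioc a b) := by
    refine ENNReal.toReal_pos (fun h => ?_) (measure_ne_top _ _)
    have := gaussianReal_absolutelyContinuous' 0 one_ne_zero h
    simp at this
    linarith
  change (gaussianReal 0 1).real _ < (gaussianReal 0 1).real _
  linarith

lemma Phi_neg (b : ℝ) : Phi (-b) = 1 - Phi b := by
  have := nullSingletonClass_gaussianReal (μ := 0) (v := 1) one_ne_zero
  have h1 : gaussianReal 0 1 (Set.Iic (-b)) = gaussianReal 0 1 (Set.Ici b) := by
    conv_lhs => rw [← neg_zero (G := ℝ), ← gaussianReal_map_neg,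
      Measure.map_apply (by fun_prop) measurableSet_Iic]
    congr 1; ext z; simp
  have h2 : (gaussianReal 0 1).real (Set.Iic b)ᶜ = 1 - (gaussianReal 0 1).real (Set.Iic b) :=
    probReal_compl_eq_one_sub measurableSet_Iic
  change _ = 1 - (gaussianReal 0 1).real (Set.Iic b)
  rw [← h2, Phi, h1, Set.compl_Iic, Measure.real, measure_congr Ioi_ae_eq_Ici]

lemma Phi_continuous : Continuous Phi := by
  have := nullSingletonClass_gaussianReal (μ := 0) (v := 1) one_ne_zero
  have e : Phi = fun x => cdf (gaussianReal 0 1) x := by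
    ext x; rw [cdf_eq_real]; rfl
  rw [e, continuous_iff_continuousAt]
  intro x
  rw [(monotone_cdf _).continuousAt_iff_leftLim_eq_rightLim, (cdf _).rightLim_eq]
  have h := (cdf (gaussianReal 0 1)).measure_singleton x
  rw [measure_cdf, measure_singleton] at h
  have h1 := ENNReal.ofReal_eq_zero.1 h.symm
  exact le_antisymm ((monotone_cdf _).leftLim_le le_rfl) (by linarith)

lemma Phi_PhiInv {p : ℝ} (h0 : 0 < p) (h1 : p < 1) : Phi (PhiInv p) = p := by
  refine Function.invFun_eq ?_
  have e : Phi = fun x => cdf (gaussianReal 0 1) x := by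
    ext x; rw [cdf_eq_real]; rfl
  have hb : ∃ a, Phi a < p := by
    rw [e]; exact ((tendsto_cdf_atBot _).eventually_lt_const h0).exists
  have ht : ∃ a, p < Phi a := by
    rw [e]; exact ((tendsto_cdf_atTop _).eventually_const_lt h1).exists
  obtain ⟨a, ha⟩ := hb
  obtain ⟨b, hb⟩ := ht
  exact mem_range_of_exists_le_of_exists_ge Phi_continuous ⟨a, ha.le⟩ ⟨b, hb.le⟩

/-- Randomized smoothing with anisotropic Gaussian noise. -/
theorem anisotropic_randomized_smoothing
    {d : ℕ} (hd : 0 < d) {Y : Type*} [Fintype Y] [MeasurableSpace Y] [MeasurableSingletonClass Y]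
    (f : (Fin d → ℝ) → Y) (hf : Measurable f)
    (μ : Fin d → ℝ) (σ : Fin d → ℝ) (hσ : ∀ i, 0 < σ i)
    (noise : Measure (Fin d → ℝ))
    (hnoise : noise = Measure.pi fun i : Fin d => gaussianReal (μ i) ((σ i ^ 2).toNNReal))
    (x : Fin d → ℝ) (cA : Y) (pA pB : ℝ)
    (hpA : pA ∈ Set.Icc (0 : ℝ) 1) (hpB : pB ∈ Set.Icc (0 : ℝ) 1)
    (hA : (noise {e | f (x + e) = cA}).toReal ≥ pA)
    (hAB : pA ≥ pB)
    (hB : ∀ c : Y, c ≠ cA → pB ≥ (noise {e | f (x + e) = c}).toReal)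
    (δ : Fin d → ℝ)
    (hδ : Real.sqrt (∑ i, δ i ^ 2) <
      (1 / 2) * (Finset.univ.inf' ⟨⟨0, hd⟩, Finset.mem_univ _⟩ σ) * (PhiInv pA - PhiInv pB)) :
    ∀ c : Y, c ≠ cA →
      (noise {e | f (x + δ + e) = cA}).toReal >
        (noise {e | f (x + δ + e) = c}).toReal := by
  -- reduce to the standard Gaussian
  have hN : noise = (stdG d).map (fun z i => σ i * z i + μ i) := by
    have hm : ∀ i, (gaussianReal 0 1).map (fun z => σ i * z + μ i) =
        gaussianReal (μ i) ((σ i ^ 2).toNNReal) := by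
      intro i
      have : (fun z => σ i * z + μ i) = (fun z => z + μ i) ∘ (fun z => σ i * z) := rfl
      rw [this, ← Measure.map_map (by fun_prop) (by fun_prop), gaussianReal_map_const_mul,
        gaussianReal_map_add_const]
      congr 1
      · simp
      · ext; simp [sq_nonneg]
    have := Measure.pi_map_pi (μ := fun _ : Fin d => gaussianReal 0 1)
      (f := fun i z => σ i * z + μ i) (hμ := fun i => by rw [hm]; infer_instance)
      (fun i => by fun_prop)
    simp_rw [hm] at this
    rw [hnoise, ← this, stdG]
  let S : Y → Set (Fin d → ℝ) := fun c => {z | f (x + fun i => σ i * z i + μ i) = c}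
  let w : Fin d → ℝ := fun i => δ i / σ i
  have hSm : ∀ c, MeasurableSet (S c) := fun c => by
    have : Measurable fun z : Fin d → ℝ => f (x + fun i => σ i * z i + μ i) :=
      hf.comp (by fun_prop)
    exact this (measurableSet_singleton c)
  have e1 : ∀ c, (noise {e | f (x + e) = c}).toReal = (stdG d).real (S c) := fun c => by
    have : MeasurableSet {e | f (x + e) = c} :=
      (hf.comp (measurable_const_add x)) (measurableSet_singleton c)
    rw [hN, Measure.map_apply (by fun_prop) this]; rfl
  have e2 : ∀ c, (noise {e | f (x + δ + e) = c}).toReal = (stdG d).real {z | z + w ∈ S c} :=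
    fun c => by
    have : MeasurableSet {e | f (x + δ + e) = c} :=
      (hf.comp (measurable_const_add (x + δ))) (measurableSet_singleton c)
    rw [hN, Measure.map_apply (by fun_prop) this, Measure.real]
    congr 2
    ext z
    have : (x + δ + fun i => σ i * z i + μ i) = x + fun i => σ i * (z + w) i + μ i := by
      ext i
      have := (hσ i).ne'
      simp only [Pi.add_apply, w]
      field_simp
      ring
    simp only [Set.mem_preimage, Set.mem_ofPred_eq, S, this]
  simp_rw [e1] at hA hB
  simp_rw [e2]
  clear e1 e2 hN hnoise
  intro c hc
  have hdisj : ∀ z, z ∈ S c → z ∉ S cA := fun z h h' => hc (h.symm.trans h')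
  by_cases hfull : (stdG d).real (S cA)ᶜ = 0
  · have hac : (stdG d).real {z | z + w ∈ (S cA)ᶜ} = 0 := by
      rw [shift_real w (hSm cA).compl]
      refine setIntegral_measure_zero _ ?_
      simpa [Measure.real, ENNReal.toReal_eq_zero_iff] using hfull
    have h1 : (stdG d).real {z | z + w ∈ S c} ≤ (stdG d).real {z | z + w ∈ (S cA)ᶜ} :=
      measureReal_mono fun z hz => hdisj _ hz
    have h2 : (stdG d).real {z | z + w ∈ (S cA)ᶜ} = 1 - (stdG d).real {z | z + w ∈ S cA} :=
      probReal_compl_eq_one_sub ((measurable_add_const w) (hSm cA))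
    linarith
  have hcomp := probReal_compl_eq_one_sub (μ := stdG d) (hSm cA)
  have hpos : 0 < (stdG d).real (S cA)ᶜ := lt_of_le_of_ne measureReal_nonneg (Ne.symm hfull)
  have hA1 : pA < 1 := by linarith
  have hB0 : 0 < pB := by
    by_contra hcon
    apply hfull
    have hz : ∀ c', c' ≠ cA → stdG d (S c') = 0 := fun c' h' => by
      have : (stdG d).real (S c') = 0 :=
        le_antisymm ((hB c' h').trans (not_lt.1 hcon)) measureReal_nonneg
      simpa [Measure.real, ENNReal.toReal_eq_zero_iff] using this
    have hsub : (S cA)ᶜ ⊆ ⋃ c' : {c' : Y // c' ≠ cA}, S c' := fun z hz =>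
      Set.mem_iUnion.2 ⟨⟨f (x + fun i => σ i * z i + μ i), hz⟩, rfl⟩
    have : stdG d (S cA)ᶜ = 0 :=
      measure_mono_null hsub (measure_iUnion_null fun c' => hz c' c'.2)
    simp [Measure.real, this]
  have hPA := Phi_PhiInv (hB0.trans_le hAB) hA1
  have hPB := Phi_PhiInv hB0 (lt_of_le_of_lt hAB hA1)
  have n1 := np w (hSm cA) (PhiInv pA) (by rw [hPA]; exact hA)
  have n2 := np w (hSm c).compl (-PhiInv pB) (by
    rw [Phi_neg, hPB, probReal_compl_eq_one_sub (hSm c)]; linarith [hB c hc])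
  have h2 : (stdG d).real {z | z + w ∈ (S c)ᶜ} = 1 - (stdG d).real {z | z + w ∈ S c} :=
    probReal_compl_eq_one_sub ((measurable_add_const w) (hSm c))
  set m := Finset.univ.inf' ⟨⟨0, hd⟩, Finset.mem_univ _⟩ σ with hm
  have hm0 : 0 < m := (Finset.lt_inf'_iff _).2 fun i _ => hσ i
  have hms : ∀ i, m ≤ σ i := fun i => Finset.inf'_le _ (Finset.mem_univ i)
  have hs : Real.sqrt (∑ i, w i ^ 2) ≤ Real.sqrt (∑ i, δ i ^ 2) / m := by
    rw [le_div_iff₀ hm0, ← Real.sqrt_sq hm0.le, ← Real.sqrt_mul (Finset.sum_nonneg fun i _ => sq_nonneg _)]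
    refine Real.sqrt_le_sqrt ?_
    rw [Finset.sum_mul]
    refine Finset.sum_le_sum fun i _ => ?_
    simp only [w]
    rw [div_pow, div_mul_eq_mul_div, div_le_iff₀ (pow_pos (hσ i) 2)]
    exact mul_le_mul_of_nonneg_left (pow_le_pow_left₀ hm0.le (hms i) 2) (sq_nonneg _)
  have hs2 : Real.sqrt (∑ i, δ i ^ 2) / m < (1 / 2) * (PhiInv pA - PhiInv pB) := by
    rw [div_lt_iff₀ hm0]; linarith
  have hlt := Phi_strictMono (show PhiInv pB + Real.sqrt (∑ i, w i ^ 2) <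
    PhiInv pA - Real.sqrt (∑ i, w i ^ 2) by linarith)
  have h3 : -PhiInv pB - Real.sqrt (∑ i, w i ^ 2) = -(PhiInv pB + Real.sqrt (∑ i, w i ^ 2)) := by ring
  rw [h3, Phi_neg] at n2
  linarith
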